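/- arXiv:1701.02478 — 2 statements merged into one kernel-verified Lean document; each statement's English description precedes it below -/
import Mathlib

section
/- (Lazard elimination.) Let α and β be types and let L be the free Lie algebra over ℤ on α ⊕ β, with canonical embedding ι. Let S be the Lie subalgebra of L generated by {ι(inl a) : a ∈ α} and let I be the Lie ideal of L generated by {ι(inr b) : b ∈ β}. Then: (i) the canonical Lie algebra homomorphism from the free Lie algebra over ℤ on α to L (sending each generator a to ι(inl a)) is injective with image S; (ii) as ℤ-modules, L is the internal direct sum of S and I (i.e., S ∩ I = 0 and S + I = L); (iii) I is a free Lie algebra: the Lie algebra homomorphism from the free Lie algebra over ℤ on β × List α to L sending (b, [a_1, …, a_k]) to the left-normed bracket ⁅…⁅⁅ι(inr b), ι(inl a_1)⁆, ι(inl a_2)⁆, …, ι(inl a_k)⁆ is injective with image I. -/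
/-- The canonical Lie algebra map `FreeLieAlgebra ℤ α → FreeLieAlgebra ℤ (α ⊕ β)`. -/
noncomputable def inlHom (α β : Type*) : FreeLieAlgebra ℤ α →ₗ⁅ℤ⁆ FreeLieAlgebra ℤ (α ⊕ β) :=
  FreeLieAlgebra.lift ℤ fun a => FreeLieAlgebra.of ℤ (Sum.inl a)

/-- The Lie algebra map `FreeLieAlgebra ℤ (β × List α) → FreeLieAlgebra ℤ (α ⊕ β)` sending
`(b, [a₁, …, a_k])` to the left-normed bracket `⁅…⁅⁅ι(inr b), ι(inl a₁)⁆, ι(inl a₂)⁆, …⁆`. -/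
noncomputable def brktHom (α β : Type*) :
    FreeLieAlgebra ℤ (β × List α) →ₗ⁅ℤ⁆ FreeLieAlgebra ℤ (α ⊕ β) :=
  FreeLieAlgebra.lift ℤ fun p =>
    p.2.foldl (fun u a => ⁅u, FreeLieAlgebra.of ℤ (Sum.inl a)⁆) (FreeLieAlgebra.of ℤ (Sum.inr p.1))

namespace FreeLieAlgebra

section Derivation

variable {R : Type*} [CommRing R] {X : Type*}

theorem lieSpan_range_of :
    LieSubalgebra.lieSpan R (FreeLieAlgebra R X) (Set.range (of R)) = ⊤ := by
  set K := LieSubalgebra.lieSpan R (FreeLieAlgebra R X) (Set.range (of R))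
  let g : FreeLieAlgebra R X →ₗ⁅R⁆ K :=
    lift R fun x => ⟨of R x, LieSubalgebra.subset_lieSpan ⟨x, rfl⟩⟩
  have hg : K.incl.comp g = LieHom.id := by
    ext x
    simp [g]
  refine eq_top_iff.2 fun x _ => ?_
  have hx : (g x : FreeLieAlgebra R X) = x := LieHom.congr_fun hg x
  exact hx ▸ (g x).2

/-- Induction on the elements of a free Lie algebra. -/
@[elab_as_elim]
theorem induction {p : FreeLieAlgebra R X → Prop} (of : ∀ x, p (of R x)) (zero : p 0)
    (add : ∀ x y, p x → p y → p (x + y)) (smul : ∀ (r : R) x, p x → p (r • x))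
    (lie : ∀ x y, p x → p y → p ⁅x, y⁆) (x : FreeLieAlgebra R X) : p x := by
  have hx : x ∈ LieSubalgebra.lieSpan R (FreeLieAlgebra R X) (Set.range (FreeLieAlgebra.of R)) :=
    lieSpan_range_of (R := R) (X := X) ▸ LieSubalgebra.mem_top x
  induction hx using LieSubalgebra.lieSpan_induction with
  | mem y hy => obtain ⟨z, rfl⟩ := hy; exact of z
  | zero => exact zero
  | add y z _ _ hy hz => exact add y z hy hz
  | smul r y _ hy => exact smul r y hy
  | lie y z _ _ hy hz => exact lie y z hy hz

theorem range_lift {L : Type*} [LieRing L] [LieAlgebra R L] (f : X → L) :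
    (lift R f).range = LieSubalgebra.lieSpan R L (Set.range f) := by
  rw [LieHom.range_eq_map, ← lieSpan_range_of, LieSubalgebra.map_lieSpan, ← Set.range_comp,
    of_comp_lift]

open LieAlgebra in
/-- The homomorphism `x ↦ (x, D x)` into the split extension of the free Lie algebra by a module,
where `D` is the derivation extending `f`. -/
noncomputable def derivationGraph {M : Type*} [AddCommGroup M] [Module R M]
    [LieRingModule (FreeLieAlgebra R X) M] [LieModule R (FreeLieAlgebra R X) M] (f : X → M) :
    FreeLieAlgebra R X →ₗ⁅R⁆
      ofTwoCocycle (0 : LieModule.Cohomology.twoCocycle R (FreeLieAlgebra R X) M) :=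
  lift R fun x => ofProd 0 (of R x, f x)

variable {M : Type*} [AddCommGroup M] [Module R M]
  [LieRingModule (FreeLieAlgebra R X) M] [LieModule R (FreeLieAlgebra R X) M]

theorem derivationGraph_fst (f : X → M) (x : FreeLieAlgebra R X) :
    ((LieAlgebra.ofProd 0).symm (derivationGraph f x)).1 = x := by
  induction x using FreeLieAlgebra.induction with
  | of x => simp [derivationGraph]
  | zero => simp
  | add x y hx hy => simp [hx, hy]
  | smul r x hx => simp [hx]
  | lie x y hx hy => simp [LieAlgebra.bracket_ofTwoCocycle, hx, hy]

/-- The derivation of a free Lie algebra with prescribed values on the generators. -/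
noncomputable def derivation (f : X → M) : LieDerivation R (FreeLieAlgebra R X) M where
  toFun x := ((LieAlgebra.ofProd 0).symm (derivationGraph f x)).2
  map_add' x y := by simp
  map_smul' r x := by simp
  leibniz' x y := by simp [LieAlgebra.bracket_ofTwoCocycle, derivationGraph_fst]

@[simp]
theorem derivation_of (f : X → M) (x : X) : derivation f (of R x) = f x := by
  change ((LieAlgebra.ofProd 0).symm (derivationGraph f (of R x))).2 = f x
  simp [derivationGraph]

end Derivation

end FreeLieAlgebra

namespace LazardElimination

open FreeLieAlgebra LieAlgebra

/-- The action of the free Lie algebra on `α` on the free Lie algebra on `β × List α`, in which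
the generator `a` acts by `(b, w) ↦ -(b, w ++ [a])`. -/
noncomputable def action (R : Type*) [CommRing R] (α β : Type*) :
    FreeLieAlgebra R α →ₗ⁅R⁆
      LieDerivation R (FreeLieAlgebra R (β × List α)) (FreeLieAlgebra R (β × List α)) :=
  lift R fun a => derivation fun p => -of R (p.1, p.2 ++ [a])

variable (R : Type*) [CommRing R] (α β : Type*)

/-- The canonical homomorphism from the free Lie algebra on `α` to the one on `α ⊕ β`. -/
noncomputable def inlMap : FreeLieAlgebra R α →ₗ⁅R⁆ FreeLieAlgebra R (α ⊕ β) :=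
  lift R fun a => of R (Sum.inl a)

/-- The homomorphism sending `(b, [a₁, …, a_k])` to the left-normed bracket
`⁅…⁅⁅b, a₁⁆, a₂⁆, …, a_k⁆`. -/
noncomputable def brktMap : FreeLieAlgebra R (β × List α) →ₗ⁅R⁆ FreeLieAlgebra R (α ⊕ β) :=
  lift R fun p => p.2.foldl (fun u a => ⁅u, of R (Sum.inl a)⁆) (of R (Sum.inr p.1))

/-- The homomorphism from the free Lie algebra on `α ⊕ β` to the semidirect sum. -/
noncomputable def toSemiDirectSum :
    FreeLieAlgebra R (α ⊕ β) →ₗ⁅R⁆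
      FreeLieAlgebra R (β × List α) ⋊⁅action R α β⁆ FreeLieAlgebra R α :=
  lift R <| Sum.elim (fun a => SemiDirectSum.inr _ (of R a))
    fun b => SemiDirectSum.inl _ (of R (b, []))

variable {R α β}

theorem action_of_of (a : α) (b : β) (w : List α) :
    action R α β (of R a) (of R (b, w)) = -of R (b, w ++ [a]) := by
  simp [action]

theorem brktMap_of_append (b : β) (w : List α) (a : α) :
    brktMap R α β (of R (b, w ++ [a])) = ⁅brktMap R α β (of R (b, w)), of R (Sum.inl a)⁆ := by
  simp [brktMap]

theorem brktMap_action (s : FreeLieAlgebra R α) (k : FreeLieAlgebra R (β × List α)) :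
    brktMap R α β (action R α β s k) = ⁅inlMap R α β s, brktMap R α β k⁆ := by
  induction s using FreeLieAlgebra.induction generalizing k with
  | of a =>
    induction k using FreeLieAlgebra.induction with
    | of p =>
      obtain ⟨b, w⟩ := p
      rw [action_of_of, map_neg, brktMap_of_append, lie_skew, inlMap, lift_of_apply]
    | zero => simp
    | add x y hx hy => simp [hx, hy]
    | smul r x hx => rw [map_smul, map_smul, map_smul, lie_smul, hx]
    | lie x y hx hy =>
      rw [LieDerivation.apply_lie_eq_add, map_add, LieHom.map_lie, LieHom.map_lie, LieHom.map_lie,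
        hx, hy, leibniz_lie (inlMap R α β (of R a)), add_comm]
  | zero => simp
  | add s t hs ht => simp [hs, ht]
  | smul r s hs => rw [map_smul, map_smul, LieDerivation.smul_apply, map_smul, smul_lie, hs]
  | lie s t hs ht =>
    rw [LieHom.map_lie, LieHom.map_lie, LieDerivation.lie_apply, map_sub, hs, ht, ht, hs, lie_lie]

variable (R α β) in
/-- The homomorphism from the semidirect sum to the free Lie algebra on `α ⊕ β`. -/
noncomputable def ofSemiDirectSum :
    FreeLieAlgebra R (β × List α) ⋊⁅action R α β⁆ FreeLieAlgebra R α →ₗ⁅R⁆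
      FreeLieAlgebra R (α ⊕ β) where
  toFun x := brktMap R α β x.left + inlMap R α β x.right
  map_add' x y := by simp only [SemiDirectSum.add_eq_mk, map_add]; abel
  map_smul' r x := by simp [smul_add]
  map_lie' {x y} := by
    simp only [SemiDirectSum.lie_eq_mk, map_add, map_sub, LieHom.map_lie, brktMap_action, lie_add,
      add_lie]
    rw [← lie_skew (brktMap R α β x.left) (inlMap R α β y.right)]
    abel

theorem ofSemiDirectSum_toSemiDirectSum (x : FreeLieAlgebra R (α ⊕ β)) :
    brktMap R α β (toSemiDirectSum R α β x).left + inlMap R α β (toSemiDirectSum R α β x).right =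
      x := by
  have h : (ofSemiDirectSum R α β).comp (toSemiDirectSum R α β) = LieHom.id := by
    ext (a | b) <;> simp [ofSemiDirectSum, toSemiDirectSum, inlMap, brktMap]
  exact LieHom.congr_fun h x

theorem toSemiDirectSum_inlMap (s : FreeLieAlgebra R α) :
    toSemiDirectSum R α β (inlMap R α β s) = SemiDirectSum.inr _ s := by
  have h : (toSemiDirectSum R α β).comp (inlMap R α β) = SemiDirectSum.inr _ := by
    ext a <;> simp [toSemiDirectSum, inlMap]
  exact LieHom.congr_fun h s

theorem toSemiDirectSum_brktMap (k : FreeLieAlgebra R (β × List α)) :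
    toSemiDirectSum R α β (brktMap R α β k) = SemiDirectSum.inl _ k := by
  have h : (toSemiDirectSum R α β).comp (brktMap R α β) = SemiDirectSum.inl _ := by
    refine hom_ext fun ⟨b, w⟩ => ?_
    rw [LieHom.comp_apply]
    induction w using List.reverseRecOn with
    | nil => simp [toSemiDirectSum, brktMap]
    | append_singleton w a ih =>
      rw [brktMap_of_append, LieHom.map_lie, ih]
      simp [toSemiDirectSum, action_of_of]
  exact LieHom.congr_fun h k

theorem inlMap_injective : Function.Injective (inlMap R α β) := fun s t h => by
  simpa [toSemiDirectSum_inlMap] using congrArg (toSemiDirectSum R α β) h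

theorem brktMap_injective : Function.Injective (brktMap R α β) := fun s t h => by
  simpa [toSemiDirectSum_brktMap] using congrArg (toSemiDirectSum R α β) h

theorem mem_lieSpan_inr_iff (x : FreeLieAlgebra R (α ⊕ β)) :
    x ∈ LieSubmodule.lieSpan R (FreeLieAlgebra R (α ⊕ β))
        (Set.range fun b : β => (of R (Sum.inr b) : FreeLieAlgebra R (α ⊕ β))) ↔
      (toSemiDirectSum R α β x).right = 0 := by
  set I : LieIdeal R (FreeLieAlgebra R (α ⊕ β)) :=
    LieSubmodule.lieSpan R (FreeLieAlgebra R (α ⊕ β))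
      (Set.range fun b : β => (of R (Sum.inr b) : FreeLieAlgebra R (α ⊕ β)))
  constructor
  · have h : I ≤ ((SemiDirectSum.projr (action R α β)).comp (toSemiDirectSum R α β)).ker := by
      rw [LieSubmodule.lieSpan_le]
      rintro _ ⟨b, rfl⟩
      simp [toSemiDirectSum]
    exact fun hx => by simpa using h hx
  · intro hx
    have hI (k : FreeLieAlgebra R (β × List α)) : brktMap R α β k ∈ I := by
      induction k using FreeLieAlgebra.induction with
      | of p =>
        obtain ⟨b, w⟩ := p
        induction w using List.reverseRecOn with
        | nil =>
          have hb : (of R (Sum.inr b) : FreeLieAlgebra R (α ⊕ β)) ∈ I :=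
            LieSubmodule.subset_lieSpan ⟨b, rfl⟩
          simpa [brktMap] using hb
        | append_singleton w a ih =>
          rw [brktMap_of_append]
          exact lie_mem_left _ _ I _ _ ih
      | zero => simp
      | add x y hx hy => rw [map_add]; exact add_mem hx hy
      | smul r x hx => rw [map_smul]; exact I.smul_mem r hx
      | lie x y hx hy => rw [LieHom.map_lie]; exact lie_mem_left _ _ I _ _ hx
    rw [← ofSemiDirectSum_toSemiDirectSum x, hx, map_zero, add_zero]
    exact hI _

/-- Lazard elimination over an arbitrary commutative ring. -/
theorem elimination (R : Type*) [CommRing R] (α β : Type*)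
    (S : LieSubalgebra R (FreeLieAlgebra R (α ⊕ β)))
    (hS : S = LieSubalgebra.lieSpan R _ (Set.range fun a : α => of R (Sum.inl a)))
    (I : LieIdeal R (FreeLieAlgebra R (α ⊕ β)))
    (hI : I = LieSubmodule.lieSpan R _ (Set.range fun b : β => of R (Sum.inr b))) :
    (Function.Injective (inlMap R α β) ∧ (inlMap R α β).range = S) ∧
    (S.toSubmodule ⊓ LieSubmodule.toSubmodule I = ⊥ ∧
      S.toSubmodule ⊔ LieSubmodule.toSubmodule I = ⊤) ∧
    (Function.Injective (brktMap R α β) ∧ ∀ x, x ∈ (brktMap R α β).range ↔ x ∈ I) := by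
  have hI' (x) : x ∈ I ↔ (toSemiDirectSum R α β x).right = 0 := hI ▸ mem_lieSpan_inr_iff x
  have hS' : (inlMap R α β).range = S := hS ▸ FreeLieAlgebra.range_lift _
  refine ⟨⟨inlMap_injective, hS'⟩, ⟨?_, ?_⟩, brktMap_injective, fun x => ⟨?_, fun hx => ?_⟩⟩
  · refine (Submodule.eq_bot_iff _).2 fun x ⟨hxS, hxI⟩ => ?_
    obtain ⟨s, rfl⟩ : x ∈ (inlMap R α β).range := hS' ▸ hxS
    have hs : s = 0 := by simpa [toSemiDirectSum_inlMap] using (hI' _).1 hxI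
    simp [hs]
  · refine eq_top_iff.2 fun x _ => ?_
    rw [← ofSemiDirectSum_toSemiDirectSum x, add_comm]
    refine Submodule.add_mem_sup (?_ : _ ∈ S) (?_ : _ ∈ I)
    · exact hS' ▸ LieHom.mem_range_self _ _
    · simp [hI', toSemiDirectSum_brktMap]
  · rintro ⟨k, rfl⟩
    exact (hI' _).2 (congrArg _ (toSemiDirectSum_brktMap k))
  · rw [← ofSemiDirectSum_toSemiDirectSum x, (hI' x).1 hx, map_zero, add_zero]
    exact LieHom.mem_range_self _ _

end LazardElimination

/-- Lazard elimination for the free Lie algebra over `ℤ` on `α ⊕ β`. -/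
theorem lazard_elimination (α β : Type*)
    (S : LieSubalgebra ℤ (FreeLieAlgebra ℤ (α ⊕ β)))
    (hS : S = LieSubalgebra.lieSpan ℤ _ (Set.range fun a : α => FreeLieAlgebra.of ℤ (Sum.inl a)))
    (I : LieIdeal ℤ (FreeLieAlgebra ℤ (α ⊕ β)))
    (hI : I = LieSubmodule.lieSpan ℤ _ (Set.range fun b : β => FreeLieAlgebra.of ℤ (Sum.inr b))) :
    (Function.Injective (inlHom α β) ∧ (inlHom α β).range = S) ∧
    (S.toSubmodule ⊓ LieSubmodule.toSubmodule I = ⊥ ∧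
      S.toSubmodule ⊔ LieSubmodule.toSubmodule I = ⊤) ∧
    (Function.Injective (brktHom α β) ∧ ∀ x, x ∈ (brktHom α β).range ↔ x ∈ I) :=
  LazardElimination.elimination ℤ α β S hS I hI
end

section
/- Let α and β be types and let L be the free Lie algebra over ℤ on α ⊕ β, with canonical embedding ι. Let L(U) be the Lie subalgebra of L generated by {ι(inl a) : a ∈ α}, let L(V) be the Lie subalgebra generated by {ι(inr b) : b ∈ β}, and let L(W) be the Lie ideal of L generated by all brackets ⁅ι(inr b), ι(inl a)⁆ with a ∈ α, b ∈ β. Then, as ℤ-modules, L is the internal direct sum of L(U), L(V) and L(W). -/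
/-- If a Lie ideal `C` contains the bracket of every element of `s` with every element of `t`, then
it contains the bracket of every element of the subalgebra generated by `s` with every element of
the subalgebra generated by `t`. -/
theorem LieSubalgebra.lie_mem_of_mem_lieSpan {R L : Type*} [CommRing R] [LieRing L]
    [LieAlgebra R L] {s t : Set L} {C : LieIdeal R L} (h : ∀ x ∈ s, ∀ y ∈ t, ⁅x, y⁆ ∈ C) {x y : L}
    (hx : x ∈ LieSubalgebra.lieSpan R L s) (hy : y ∈ LieSubalgebra.lieSpan R L t) :
    ⁅x, y⁆ ∈ C := by
  induction hx using LieSubalgebra.lieSpan_induction with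
  | mem x hx =>
    induction hy using LieSubalgebra.lieSpan_induction with
    | mem y hy => exact h x hx y hy
    | zero => simp
    | add y z _ _ hy hz => rw [lie_add]; exact add_mem hy hz
    | smul r y _ hy => rw [lie_smul]; exact C.smul_mem r hy
    | lie y z _ _ hy hz =>
      rw [leibniz_lie]
      exact add_mem (lie_mem_left R L C _ _ hy) (lie_mem_right R L C _ _ hz)
  | zero => simp
  | add x z _ _ hx hz => rw [add_lie]; exact add_mem hx hz
  | smul r x _ hx => rw [smul_lie]; exact C.smul_mem r hx
  | lie x z _ _ hx hz =>
    rw [lie_lie]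
    exact sub_mem (lie_mem_right R L C _ _ hz) (lie_mem_right R L C _ _ hx)

/-- A Lie homomorphism fixing `s` pointwise fixes the subalgebra generated by `s` pointwise. -/
theorem LieHom.apply_eq_self_of_mem_lieSpan {R L : Type*} [CommRing R] [LieRing L]
    [LieAlgebra R L] (f : L →ₗ⁅R⁆ L) {s : Set L} (h : ∀ x ∈ s, f x = x) {x : L}
    (hx : x ∈ LieSubalgebra.lieSpan R L s) : f x = x := by
  induction hx using LieSubalgebra.lieSpan_induction with
  | mem x hx => exact h x hx
  | zero => simp
  | add x y _ _ hx hy => rw [map_add, hx, hy]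
  | smul r x _ hx => rw [map_smul, hx]
  | lie x y _ _ hx hy => rw [LieHom.map_lie, hx, hy]

/-- A Lie subalgebra of a free Lie algebra containing all generators is everything. -/
theorem FreeLieAlgebra.mem_of_forall_of_mem {R X : Type*} [CommRing R]
    (S : LieSubalgebra R (FreeLieAlgebra R X)) (h : ∀ x, FreeLieAlgebra.of R x ∈ S)
    (x : FreeLieAlgebra R X) : x ∈ S := by
  have key : S.incl.comp (FreeLieAlgebra.lift R fun i => (⟨FreeLieAlgebra.of R i, h i⟩ : S)) =
      LieHom.id := by
    ext i
    simp
  have hx := LieHom.congr_fun key x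
  simp only [LieHom.comp_apply, LieHom.id_apply] at hx
  rw [← hx]
  exact SetLike.coe_mem _

/-- The sum of two Lie subalgebras and a Lie ideal containing their mutual brackets, as a Lie
subalgebra. -/
def LieSubalgebra.supIdeal {R L : Type*} [CommRing R] [LieRing L] [LieAlgebra R L]
    (A B : LieSubalgebra R L) (C : LieIdeal R L) (h : ∀ x ∈ B, ∀ y ∈ A, ⁅x, y⁆ ∈ C) :
    LieSubalgebra R L where
  __ := A.toSubmodule ⊔ B.toSubmodule ⊔ LieSubmodule.toSubmodule C
  lie_mem' := by
    intro x y hx hy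
    obtain ⟨_, hab, c, hc, rfl⟩ := Submodule.mem_sup.1 hx
    obtain ⟨a, ha, b, hb, rfl⟩ := Submodule.mem_sup.1 hab
    obtain ⟨_, hab', c', hc', rfl⟩ := Submodule.mem_sup.1 hy
    obtain ⟨a', ha', b', hb', rfl⟩ := Submodule.mem_sup.1 hab'
    have e : ⁅a + b + c, a' + b' + c'⁆ = ⁅a, a'⁆ + ⁅b, b'⁆ +
        (⁅b, a'⁆ - ⁅b', a⁆ + ⁅a + b + c, c'⁆ + ⁅c, a' + b'⁆) := by
      rw [← lie_skew b' a]
      simp only [add_lie, lie_add]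
      abel
    rw [e]
    refine Submodule.add_mem_sup (Submodule.add_mem_sup (A.lie_mem ha ha') (B.lie_mem hb hb')) ?_
    exact add_mem (add_mem (sub_mem (h _ hb _ ha') (h _ hb' _ ha)) (lie_mem_right R L C _ _ hc'))
      (lie_mem_left R L C _ _ hc)

/-- The decomposition of the free Lie algebra on `α ⊕ β` over an arbitrary commutative ring. -/
theorem FreeLieAlgebra.sum_decomposition (R : Type*) [CommRing R] (α β : Type*)
    (A B : LieSubalgebra R (FreeLieAlgebra R (α ⊕ β)))
    (C : LieIdeal R (FreeLieAlgebra R (α ⊕ β)))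
    (hA : A = LieSubalgebra.lieSpan R _ (Set.range fun a : α => FreeLieAlgebra.of R (Sum.inl a)))
    (hB : B = LieSubalgebra.lieSpan R _ (Set.range fun b : β => FreeLieAlgebra.of R (Sum.inr b)))
    (hC : C = LieSubmodule.lieSpan R _
      { x | ∃ (a : α) (b : β),
          x = ⁅FreeLieAlgebra.of R (Sum.inr b : α ⊕ β), FreeLieAlgebra.of R (Sum.inl a)⁆ }) :
    A.toSubmodule ⊓ (B.toSubmodule ⊔ LieSubmodule.toSubmodule C) = ⊥ ∧
    B.toSubmodule ⊓ (A.toSubmodule ⊔ LieSubmodule.toSubmodule C) = ⊥ ∧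
    LieSubmodule.toSubmodule C ⊓ (A.toSubmodule ⊔ B.toSubmodule) = ⊥ ∧
    A.toSubmodule ⊔ B.toSubmodule ⊔ LieSubmodule.toSubmodule C = ⊤ := by
  let p : FreeLieAlgebra R (α ⊕ β) →ₗ⁅R⁆ FreeLieAlgebra R (α ⊕ β) :=
    FreeLieAlgebra.lift R (Sum.elim (fun a => FreeLieAlgebra.of R (Sum.inl a)) fun _ => 0)
  let q : FreeLieAlgebra R (α ⊕ β) →ₗ⁅R⁆ FreeLieAlgebra R (α ⊕ β) :=
    FreeLieAlgebra.lift R (Sum.elim (fun _ => 0) fun b => FreeLieAlgebra.of R (Sum.inr b))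
  have pA : ∀ x ∈ A, p x = x := fun x hx =>
    p.apply_eq_self_of_mem_lieSpan (by rintro _ ⟨a, rfl⟩; simp [p]) (hA ▸ hx)
  have qB : ∀ x ∈ B, q x = x := fun x hx =>
    q.apply_eq_self_of_mem_lieSpan (by rintro _ ⟨b, rfl⟩; simp [q]) (hB ▸ hx)
  have pB : ∀ x ∈ B, p x = 0 := by
    have : B ≤ p.ker.toLieSubalgebra := by
      rw [hB, LieSubalgebra.lieSpan_le]
      rintro _ ⟨b, rfl⟩
      exact LieHom.mem_ker.2 (by simp [p])
    exact fun x hx => LieHom.mem_ker.1 (this hx)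
  have qA : ∀ x ∈ A, q x = 0 := by
    have : A ≤ q.ker.toLieSubalgebra := by
      rw [hA, LieSubalgebra.lieSpan_le]
      rintro _ ⟨a, rfl⟩
      exact LieHom.mem_ker.2 (by simp [q])
    exact fun x hx => LieHom.mem_ker.1 (this hx)
  have pC : ∀ x ∈ C, p x = 0 := by
    have : C ≤ p.ker := by
      rw [hC, LieSubmodule.lieSpan_le]
      rintro _ ⟨a, b, rfl⟩
      exact LieHom.mem_ker.2 (by simp [p])
    exact fun x hx => LieHom.mem_ker.1 (this hx)
  have qC : ∀ x ∈ C, q x = 0 := by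
    have : C ≤ q.ker := by
      rw [hC, LieSubmodule.lieSpan_le]
      rintro _ ⟨a, b, rfl⟩
      exact LieHom.mem_ker.2 (by simp [q])
    exact fun x hx => LieHom.mem_ker.1 (this hx)
  have hBA : ∀ x ∈ B, ∀ y ∈ A, ⁅x, y⁆ ∈ C := by
    intro x hx y hy
    refine LieSubalgebra.lie_mem_of_mem_lieSpan ?_ (hB ▸ hx) (hA ▸ hy)
    rintro _ ⟨b, rfl⟩ _ ⟨a, rfl⟩
    rw [hC]
    exact LieSubmodule.subset_lieSpan ⟨a, b, rfl⟩
  refine ⟨?_, ?_, ?_, ?_⟩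
  · refine (Submodule.eq_bot_iff _).2 fun x ⟨hx, hx'⟩ => ?_
    obtain ⟨b, hb, c, hc, rfl⟩ := Submodule.mem_sup.1 hx'
    rw [← pA _ hx, map_add, pB b hb, pC c hc, add_zero]
  · refine (Submodule.eq_bot_iff _).2 fun x ⟨hx, hx'⟩ => ?_
    obtain ⟨a, ha, c, hc, rfl⟩ := Submodule.mem_sup.1 hx'
    rw [← qB _ hx, map_add, qA a ha, qC c hc, add_zero]
  · refine (Submodule.eq_bot_iff _).2 fun x ⟨hx, hx'⟩ => ?_
    obtain ⟨a, ha, b, hb, rfl⟩ := Submodule.mem_sup.1 hx'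
    have hp := pC _ hx
    have hq := qC _ hx
    rw [map_add, pA a ha, pB b hb, add_zero] at hp
    rw [map_add, qA a ha, qB b hb, zero_add] at hq
    rw [hp, hq, add_zero]
  · refine Submodule.eq_top_iff'.2 fun x =>
      FreeLieAlgebra.mem_of_forall_of_mem (A.supIdeal B C hBA) ?_ x
    rintro (a | b)
    · refine Submodule.mem_sup_left (Submodule.mem_sup_left ?_)
      rw [hA]
      exact LieSubalgebra.subset_lieSpan ⟨a, rfl⟩
    · refine Submodule.mem_sup_left (Submodule.mem_sup_right ?_)
      rw [hB]
      exact LieSubalgebra.subset_lieSpan ⟨b, rfl⟩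

/-- `L(U ⊕ V)` is, as a `ℤ`-module, the internal direct sum of the Lie subalgebra `L(U)`
generated by the `inl` generators, the Lie subalgebra `L(V)` generated by the `inr`
generators, and the Lie ideal `L(W)` generated by the brackets `⁅ι(inr b), ι(inl a)⁆`. -/
theorem free_lie_decomposition (α β : Type*)
    (A B : LieSubalgebra ℤ (FreeLieAlgebra ℤ (α ⊕ β)))
    (C : LieIdeal ℤ (FreeLieAlgebra ℤ (α ⊕ β)))
    (hA : A = LieSubalgebra.lieSpan ℤ _ (Set.range fun a : α => FreeLieAlgebra.of ℤ (Sum.inl a)))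
    (hB : B = LieSubalgebra.lieSpan ℤ _ (Set.range fun b : β => FreeLieAlgebra.of ℤ (Sum.inr b)))
    (hC : C = LieSubmodule.lieSpan ℤ _
      { x | ∃ (a : α) (b : β),
          x = ⁅FreeLieAlgebra.of ℤ (Sum.inr b : α ⊕ β), FreeLieAlgebra.of ℤ (Sum.inl a)⁆ }) :
    A.toSubmodule ⊓ (B.toSubmodule ⊔ LieSubmodule.toSubmodule C) = ⊥ ∧
    B.toSubmodule ⊓ (A.toSubmodule ⊔ LieSubmodule.toSubmodule C) = ⊥ ∧
    LieSubmodule.toSubmodule C ⊓ (A.toSubmodule ⊔ B.toSubmodule) = ⊥ ∧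
    A.toSubmodule ⊔ B.toSubmodule ⊔ LieSubmodule.toSubmodule C = ⊤ := by
  exact FreeLieAlgebra.sum_decomposition ℤ α β A B C hA hB hC
end
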